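/- Let R > 0 and let μ = (1/2)(δ_{−R} + δ_R) be the symmetric two-point measure on ℝ. Then for every 0 < δ ≤ R², the convolution μ_δ = μ * γ_δ satisfies a logarithmic Sobolev inequality with constant c(δ) ≤ 117942 · (δ^{3/2}/R) · exp(R²/(2δ)). -/

import Mathlib

open MeasureTheory Real

/-- Centered Gaussian measure on ℝ of variance δ. -/
noncomputable def gaussianMeasure (δ : ℝ) : Measure ℝ :=
  volume.withDensity fun t => ENNReal.ofReal ((Real.sqrt (2 * π * δ))⁻¹ * Real.exp (-(t ^ 2) / (2 * δ)))

/-- Convolution of two measures on ℝ. -/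
noncomputable def mconv (μ ν : Measure ℝ) : Measure ℝ :=
  (μ.prod ν).map fun p => p.1 + p.2

/-- Entropy functional Ent_ν(g) = ∫ g log (g / ∫ g dν) dν. -/
noncomputable def Ent {α : Type*} [MeasurableSpace α] (ν : Measure α) (g : α → ℝ) : ℝ :=
  ∫ x, g x * Real.log (g x / ∫ y, g y ∂ν) ∂ν

/-- ν satisfies a logarithmic Sobolev inequality with constant c:
Ent_ν(f²) ≤ c ∫ |f'|² dν for all smooth compactly supported f : ℝ → ℝ. -/
def SatisfiesLSI (ν : Measure ℝ) (c : ℝ) : Prop :=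
  ∀ f : ℝ → ℝ, ContDiff ℝ (⊤ : ℕ∞) f → HasCompactSupport f →
    Ent ν (fun t => f t ^ 2) ≤ c * ∫ t, deriv f t ^ 2 ∂ν

theorem sq_sub_le_mul_integral_exp {f : ℝ → ℝ} (hf : ContDiff ℝ 1 f) (a : ℝ) {x J : ℝ}
    (hx : 0 ≤ x) (hJ : 0 < J)
    (hE : ∫ s in (0 : ℝ)..x, deriv f s ^ 2 * exp (-(s - a) ^ 2 / 2) ≤ J) :
    (f x - f 0) ^ 2 ≤ J * ∫ s in (0 : ℝ)..x, exp ((s - a) ^ 2 / 2) := by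
  have hd : Continuous (deriv f) := hf.continuous_deriv le_rfl
  have hftc : ∫ s in (0 : ℝ)..x, deriv f s = f x - f 0 :=
    intervalIntegral.integral_deriv_eq_sub
      (fun s _ => (hf.differentiable one_ne_zero).differentiableAt) (hd.intervalIntegrable _ _)
  set k := (f x - f 0) / J with hk
  have hpos : 0 ≤ ∫ s in (0 : ℝ)..x, (k ^ 2 * (deriv f s ^ 2 * exp (-(s - a) ^ 2 / 2))
      - 2 * k * deriv f s + exp ((s - a) ^ 2 / 2)) := by
    refine intervalIntegral.integral_nonneg hx fun s _ => ?_
    have h1 : exp ((s - a) ^ 2 / 2) * exp (-(s - a) ^ 2 / 2) = 1 := by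
      rw [← exp_add]; ring_nf; exact exp_zero
    have h2 := exp_pos ((s - a) ^ 2 / 2)
    have h3 := exp_pos (-(s - a) ^ 2 / 2)
    have : k ^ 2 * (deriv f s ^ 2 * exp (-(s - a) ^ 2 / 2)) - 2 * k * deriv f s
        + exp ((s - a) ^ 2 / 2)
        = exp (-(s - a) ^ 2 / 2) * (k * deriv f s - exp ((s - a) ^ 2 / 2)) ^ 2 := by
      linear_combination (2 * k * deriv f s - exp ((s - a) ^ 2 / 2)) * h1
    rw [this]; positivity
  rw [intervalIntegral.integral_add (by apply Continuous.intervalIntegrable; fun_prop)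
      (by apply Continuous.intervalIntegrable; fun_prop),
    intervalIntegral.integral_sub (by apply Continuous.intervalIntegrable; fun_prop)
      (by apply Continuous.intervalIntegrable; fun_prop),
    intervalIntegral.integral_const_mul, intervalIntegral.integral_const_mul, hftc] at hpos
  have h4 := mul_le_mul_of_nonneg_left hE (sq_nonneg k)
  have h5 : k * J = f x - f 0 := by rw [hk]; field_simp
  have h6 : 0 ≤ k ^ 2 * J - 2 * k * (f x - f 0) + ∫ s in (0 : ℝ)..x, exp ((s - a) ^ 2 / 2) := by
    linarith
  have h7 := mul_nonneg hJ.le h6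
  rw [← h5] at h7 ⊢
  nlinarith

theorem integral_exp_sq_le {a x : ℝ} (ha : 1 ≤ a) (hx : 0 ≤ x) :
    ∫ s in (0 : ℝ)..x, exp ((s - a) ^ 2 / 2) ≤ 3 * (exp (a ^ 2 / 2) / a) * exp ((x - a) ^ 2) := by
  have ha0 : 0 < a := by linarith
  have hT : 1 ≤ exp (a ^ 2 / 2) / a := by
    rw [le_div_iff₀ ha0]
    have := add_one_le_exp (a ^ 2 / 2)
    nlinarith [sq_nonneg (a - 1)]
  have hint : ∀ u v : ℝ, IntervalIntegrable (fun s => exp ((s - a) ^ 2 / 2)) volume u v :=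
    fun u v => by apply Continuous.intervalIntegrable; fun_prop
  have hleft : ∀ z, 0 ≤ z → z ≤ a →
      ∫ s in (0 : ℝ)..z, exp ((s - a) ^ 2 / 2) ≤ 2 * (exp (a ^ 2 / 2) / a) := by
    intro z hz hza
    have hprim : ∫ s in (0 : ℝ)..z, exp (a ^ 2 / 2) * exp (-(a / 2) * s)
        = exp (a ^ 2 / 2) * (2 / a) * (1 - exp (-(a / 2) * z)) := by
      have hder : ∀ s ∈ Set.uIcc 0 z, HasDerivAt
          (fun s => exp (a ^ 2 / 2) * (2 / a) * (1 - exp (-(a / 2) * s)))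
          (exp (a ^ 2 / 2) * exp (-(a / 2) * s)) s := by
        intro s _
        have h := ((((hasDerivAt_id s).const_mul (-(a / 2))).exp.const_sub 1).const_mul
          (exp (a ^ 2 / 2) * (2 / a)))
        refine h.congr_deriv ?_
        simp only [id, mul_one]
        field_simp
      rw [intervalIntegral.integral_eq_sub_of_hasDerivAt hder
        (by apply Continuous.intervalIntegrable; fun_prop)]
      simp
    calc _ ≤ ∫ s in (0 : ℝ)..z, exp (a ^ 2 / 2) * exp (-(a / 2) * s) := by
          refine intervalIntegral.integral_mono_on hz (hint _ _)
            (by apply Continuous.intervalIntegrable; fun_prop) fun s hs => ?_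
          rw [← exp_add, exp_le_exp]
          nlinarith [mul_nonneg hs.1 (sub_nonneg.2 (hs.2.trans hza))]
      _ = exp (a ^ 2 / 2) * (2 / a) * (1 - exp (-(a / 2) * z)) := hprim
      _ ≤ exp (a ^ 2 / 2) * (2 / a) * 1 := by
          gcongr
          linarith [exp_pos (-(a / 2) * z)]
      _ = _ := by ring
  have hexp : 1 ≤ exp ((x - a) ^ 2) := one_le_exp (sq_nonneg _)
  rcases le_total x a with h | h
  · have := hleft x hx h
    nlinarith
  · rw [← intervalIntegral.integral_add_adjacent_intervals (hint 0 a) (hint a x)]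
    have h1 := hleft a ha0.le le_rfl
    have h2 : ∫ s in a..x, exp ((s - a) ^ 2 / 2) ≤ exp ((x - a) ^ 2) := by
      calc _ ≤ ∫ s in a..x, exp ((x - a) ^ 2 / 2) := by
            refine intervalIntegral.integral_mono_on h (hint _ _)
              (by apply Continuous.intervalIntegrable; fun_prop) fun s hs => ?_
            rw [exp_le_exp]
            nlinarith [hs.1, hs.2]
        _ = (x - a) * exp ((x - a) ^ 2 / 2) := by simp
        _ ≤ exp ((x - a) ^ 2 / 2) * exp ((x - a) ^ 2 / 2) := by
            gcongr
            have := add_one_le_exp ((x - a) ^ 2 / 2)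
            nlinarith [sq_nonneg (x - a - 1)]
        _ = _ := by rw [← exp_add]; ring_nf
    nlinarith

theorem sq_mul_log_sub_le {f m τ Y : ℝ} (hτ : 0 < τ) (hY : 0 ≤ Y)
    (h : (f - m) ^ 2 ≤ 3 * τ * exp Y) :
    f ^ 2 * log (f ^ 2 / (m ^ 2 + τ)) - f ^ 2 + (m ^ 2 + τ)
      ≤ 3 * τ + 15 * (f - m) ^ 2 + 4 * ((f - m) ^ 2 * Y) := by
  obtain ⟨d, rfl⟩ : ∃ d, f = m + d := ⟨f - m, by ring⟩
  rw [add_sub_cancel_left] at *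
  set c := m ^ 2 + τ with hc
  have hcpos : 0 < c := by positivity
  have hdY : 0 ≤ d ^ 2 * Y := by positivity
  rcases eq_or_ne (m + d) 0 with h0 | h0
  · rw [h0]
    have : m = -d := by linarith
    rw [hc, this]; norm_num
    nlinarith [sq_nonneg d]
  have hfpos : 0 < (m + d) ^ 2 := by positivity
  rcases le_total (d ^ 2) c with hd | hd
  · have h1 := log_le_sub_one_of_pos (div_pos hfpos hcpos)
    have h2 : (m + d) ^ 2 * log ((m + d) ^ 2 / c) - (m + d) ^ 2 + c ≤ ((m + d) ^ 2 - c) ^ 2 / c := by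
      calc _ ≤ (m + d) ^ 2 * ((m + d) ^ 2 / c - 1) - (m + d) ^ 2 + c := by gcongr
        _ = _ := by field_simp; ring
    have h3 : ((m + d) ^ 2 - c) ^ 2 / c ≤ 3 * τ + 15 * d ^ 2 := by
      rw [div_le_iff₀ hcpos]
      have e1 : (m + d) ^ 2 - c = 2 * m * d + d ^ 2 - τ := by rw [hc]; ring
      have e2 : (2 * m * d + d ^ 2 - τ) ^ 2 ≤ 3 * ((2 * m * d) ^ 2 + (d ^ 2) ^ 2 + τ ^ 2) := by
        nlinarith [sq_nonneg (2 * m * d - d ^ 2), sq_nonneg (2 * m * d + τ), sq_nonneg (d ^ 2 + τ)]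
      have e3 : m ^ 2 * d ^ 2 ≤ c * d ^ 2 := by gcongr; linarith
      have e4 : d ^ 2 * d ^ 2 ≤ c * d ^ 2 := by gcongr
      have e5 : τ * τ ≤ c * τ := by gcongr; nlinarith [sq_nonneg m]
      rw [e1]; nlinarith
    linarith
  · have hmd : m ^ 2 ≤ d ^ 2 := by linarith
    have hf4 : (m + d) ^ 2 ≤ 4 * d ^ 2 := by nlinarith [sq_nonneg (m - d)]
    have h12 : (m + d) ^ 2 / c ≤ 12 * exp Y := by
      rw [div_le_iff₀ hcpos]
      have : τ * exp Y ≤ c * exp Y := by gcongr; nlinarith [sq_nonneg m]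
      nlinarith
    have hlog : log ((m + d) ^ 2 / c) ≤ 3 + Y := by
      rw [log_le_iff_le_exp (div_pos hfpos hcpos), exp_add]
      refine h12.trans (by
        gcongr
        have := exp_one_gt_d9
        have e : exp 3 = exp 1 ^ 3 := by rw [← exp_nat_mul]; norm_num
        rw [e]
        calc (12 : ℝ) ≤ 2.7 ^ 3 := by norm_num
          _ ≤ _ := by gcongr; linarith)
    have h5 : (m + d) ^ 2 * log ((m + d) ^ 2 / c) ≤ 4 * d ^ 2 * (3 + Y) := by
      calc _ ≤ (m + d) ^ 2 * (3 + Y) := by gcongr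
        _ ≤ _ := by gcongr
    nlinarith

theorem integral_sq_mul_sq_mul_exp_le {f : ℝ → ℝ} (hf : ContDiff ℝ 1 f) {a N : ℝ} (ha : 0 ≤ a)
    (hN : a ≤ N) :
    ∫ x in (0 : ℝ)..N, (f x - f 0) ^ 2 * (x - a) ^ 2 * exp (-(x - a) ^ 2 / 2)
      ≤ 2 * (∫ x in (0 : ℝ)..N, (f x - f 0) ^ 2 * exp (-(x - a) ^ 2 / 2))
        + 4 * ∫ x in (0 : ℝ)..N, deriv f x ^ 2 * exp (-(x - a) ^ 2 / 2) := by
  have hd : Continuous (deriv f) := hf.continuous_deriv le_rfl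
  have hc : Continuous f := hf.continuous
  have hder : ∀ x ∈ Set.uIcc 0 N, HasDerivAt
      (fun x => (f x - f 0) ^ 2 * ((x - a) * exp (-(x - a) ^ 2 / 2)))
      (2 * (f x - f 0) * deriv f x * (x - a) * exp (-(x - a) ^ 2 / 2)
        + (f x - f 0) ^ 2 * (1 - (x - a) ^ 2) * exp (-(x - a) ^ 2 / 2)) x := by
    intro x _
    have h1 := (((hf.differentiable one_ne_zero).differentiableAt (x := x)).hasDerivAt.sub_const
      (f 0)).pow 2
    have h2 := (hasDerivAt_id x).sub_const a
    have h3 := h2.mul ((h2.pow 2).neg.div_const 2).exp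
    refine (h1.mul h3).congr_deriv ?_
    simp
    ring
  have hftc := intervalIntegral.integral_eq_sub_of_hasDerivAt hder
    (by apply Continuous.intervalIntegrable; fun_prop)
  have hbd : 0 ≤ (f N - f 0) ^ 2 * ((N - a) * exp (-(N - a) ^ 2 / 2)) := by
    have := sub_nonneg.2 hN
    positivity
  simp only [sub_self, ne_eq, OfNat.ofNat_ne_zero, not_false_eq_true, zero_pow, zero_mul,
    sub_zero] at hftc
  have hmono := intervalIntegral.integral_mono_on (μ := volume) (ha.trans hN)
    (f := fun x => 2 * (f x - f 0) * deriv f x * (x - a) * exp (-(x - a) ^ 2 / 2)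
        + (f x - f 0) ^ 2 * (1 - (x - a) ^ 2) * exp (-(x - a) ^ 2 / 2))
    (g := fun x => ((f x - f 0) ^ 2 * exp (-(x - a) ^ 2 / 2)
      + 2 * (deriv f x ^ 2 * exp (-(x - a) ^ 2 / 2)))
      - 1 / 2 * ((f x - f 0) ^ 2 * (x - a) ^ 2 * exp (-(x - a) ^ 2 / 2)))
    (by apply Continuous.intervalIntegrable; fun_prop)
    (by apply Continuous.intervalIntegrable; fun_prop) (fun x _ => by
      have := mul_nonneg (sq_nonneg ((f x - f 0) * (x - a) - 2 * deriv f x))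
        (exp_pos (-(x - a) ^ 2 / 2)).le
      nlinarith)
  rw [hftc, intervalIntegral.integral_sub (by apply Continuous.intervalIntegrable; fun_prop)
      (by apply Continuous.intervalIntegrable; fun_prop),
    intervalIntegral.integral_add (by apply Continuous.intervalIntegrable; fun_prop)
      (by apply Continuous.intervalIntegrable; fun_prop),
    intervalIntegral.integral_const_mul, intervalIntegral.integral_const_mul] at hmono
  linarith

theorem integral_exp_neg_sq_half (a : ℝ) : ∫ x, exp (-(x - a) ^ 2 / 2) = √(2 * π) := by
  have h := integral_sub_right_eq_self (μ := volume) (fun x : ℝ => exp (-(1 / 2) * x ^ 2)) a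
  rw [integral_gaussian, show π / (1 / 2) = 2 * π by ring] at h
  rw [← h]
  refine integral_congr_ae (.of_forall fun x => ?_)
  simp only
  ring_nf

theorem integrable_exp_neg_sq_half (a : ℝ) : Integrable fun x => exp (-(x - a) ^ 2 / 2) := by
  have h := (integrable_exp_neg_mul_sq (b := 1 / 2) (by norm_num)).comp_sub_right a
  refine h.congr (.of_forall fun x => ?_)
  simp only
  ring_nf

theorem continuous_sq_mul_log_div {f : ℝ → ℝ} (hf : Continuous f) {c : ℝ} (hc : c ≠ 0) :
    Continuous fun x => f x ^ 2 * log (f x ^ 2 / c) := by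
  have := (Real.continuous_mul_log.comp ((hf.pow 2).div_const c)).const_mul c
  refine this.congr fun x => ?_
  simp only [Function.comp, Pi.pow_apply]
  field_simp

theorem integral_sq_mul_log_mul_exp_le {f : ℝ → ℝ} (hf : ContDiff ℝ 1 f) {a N J : ℝ} (ha : 1 ≤ a)
    (hN : a ≤ N) (hJ : 0 < J)
    (hE : ∫ x in (0 : ℝ)..N, deriv f x ^ 2 * exp (-(x - a) ^ 2 / 2) ≤ J) {c : ℝ}
    (hc : c = f 0 ^ 2 + exp (a ^ 2 / 2) / a * J) :
    ∫ x in (0 : ℝ)..N, (f x ^ 2 * log (f x ^ 2 / c) - f x ^ 2 + c) * exp (-(x - a) ^ 2 / 2)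
      ≤ 13000 * (exp (a ^ 2 / 2) / a * J) := by
  have ha0 : 0 < a := by linarith
  have hN0 : 0 ≤ N := by linarith
  have hT : 1 ≤ exp (a ^ 2 / 2) / a := by
    rw [le_div_iff₀ ha0]
    have := add_one_le_exp (a ^ 2 / 2)
    nlinarith [sq_nonneg (a - 1)]
  set τ := exp (a ^ 2 / 2) / a * J with hτ
  have hJτ : J ≤ τ := by nlinarith
  have hτ0 : 0 < τ := by linarith
  have hd : Continuous (deriv f) := hf.continuous_deriv le_rfl
  have hcf : Continuous f := hf.continuous
  have hsup : ∀ x ∈ Set.Icc 0 N, (f x - f 0) ^ 2 ≤ 3 * τ * exp ((x - a) ^ 2) := by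
    intro x hx
    have h1 : ∫ s in (0 : ℝ)..x, deriv f s ^ 2 * exp (-(s - a) ^ 2 / 2) ≤ J := by
      refine le_trans (intervalIntegral.integral_mono_interval le_rfl hx.1 hx.2
        (.of_forall fun s => ?_) (by apply Continuous.intervalIntegrable; fun_prop)) hE
      simp only [Pi.zero_apply]
      positivity
    have h2 := sq_sub_le_mul_integral_exp hf a hx.1 hJ h1
    have h3 := mul_le_mul_of_nonneg_left (integral_exp_sq_le ha hx.1) hJ.le
    refine h2.trans (h3.trans_eq ?_)
    rw [hτ]; ring
  have hw : ∫ x in (0 : ℝ)..N, exp (-(x - a) ^ 2 / 2) ≤ 3 := by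
    rw [intervalIntegral.integral_of_le hN0]
    refine (setIntegral_le_integral (integrable_exp_neg_sq_half a)
      (.of_forall fun x => (exp_pos _).le)).trans ?_
    rw [integral_exp_neg_sq_half, Real.sqrt_le_left (by norm_num)]
    linarith [pi_lt_d2]
  set A := ∫ x in (0 : ℝ)..N, (f x - f 0) ^ 2 * exp (-(x - a) ^ 2 / 2) with hA
  set X := ∫ x in (0 : ℝ)..N, (f x - f 0) ^ 2 * (x - a) ^ 2 * exp (-(x - a) ^ 2 / 2) with hX
  have hXA : X ≤ 2 * A + 4 * J :=
    (integral_sq_mul_sq_mul_exp_le hf ha0.le hN).trans (by linarith)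
  have hAX : A ≤ 61 * τ * 3 + 1 / 3 * X := by
    have hmono := intervalIntegral.integral_mono_on (μ := volume) hN0
      (f := fun x => (f x - f 0) ^ 2 * exp (-(x - a) ^ 2 / 2))
      (g := fun x => 61 * τ * exp (-(x - a) ^ 2 / 2)
        + 1 / 3 * ((f x - f 0) ^ 2 * (x - a) ^ 2 * exp (-(x - a) ^ 2 / 2)))
      (by apply Continuous.intervalIntegrable; fun_prop)
      (by apply Continuous.intervalIntegrable; fun_prop) (fun x hx => by
        have key : (f x - f 0) ^ 2 ≤ 61 * τ + 1 / 3 * ((f x - f 0) ^ 2 * (x - a) ^ 2) := by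
          rcases le_total ((x - a) ^ 2) 3 with h | h
          · have h1 : exp ((x - a) ^ 2) ≤ exp 3 := exp_le_exp.2 h
            have e : exp 3 = exp 1 ^ 3 := by rw [← exp_nat_mul]; norm_num
            have h2 : exp 3 ≤ 61 / 3 := by
              rw [e]
              calc exp 1 ^ 3 ≤ 2.72 ^ 3 := by gcongr; linarith [exp_one_lt_d9]
                _ ≤ _ := by norm_num
            have h3 := hsup x hx
            nlinarith [mul_nonneg (sq_nonneg (f x - f 0)) (sq_nonneg (x - a))]
          · nlinarith [mul_le_mul_of_nonneg_left h (sq_nonneg (f x - f 0))]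
        have := mul_le_mul_of_nonneg_right key (exp_pos (-(x - a) ^ 2 / 2)).le
        linarith)
    rw [intervalIntegral.integral_add (by apply Continuous.intervalIntegrable; fun_prop)
        (by apply Continuous.intervalIntegrable; fun_prop),
      intervalIntegral.integral_const_mul, intervalIntegral.integral_const_mul] at hmono
    nlinarith
  have hcpos : 0 < c := by rw [hc]; positivity
  have hcont := continuous_sq_mul_log_div hcf hcpos.ne'
  have hmono := intervalIntegral.integral_mono_on (μ := volume) hN0
    (f := fun x => (f x ^ 2 * log (f x ^ 2 / c) - f x ^ 2 + c) * exp (-(x - a) ^ 2 / 2))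
    (g := fun x => (3 * τ * exp (-(x - a) ^ 2 / 2)
      + 15 * ((f x - f 0) ^ 2 * exp (-(x - a) ^ 2 / 2)))
      + 4 * ((f x - f 0) ^ 2 * (x - a) ^ 2 * exp (-(x - a) ^ 2 / 2)))
    (by apply Continuous.intervalIntegrable; fun_prop)
    (by apply Continuous.intervalIntegrable; fun_prop) (fun x hx => by
      have := mul_le_mul_of_nonneg_right
        (sq_mul_log_sub_le hτ0 (sq_nonneg (x - a)) (hsup x hx)) (exp_pos (-(x - a) ^ 2 / 2)).le
      rw [← hc] at this
      linarith)
  rw [intervalIntegral.integral_add (by apply Continuous.intervalIntegrable; fun_prop)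
      (by apply Continuous.intervalIntegrable; fun_prop),
    intervalIntegral.integral_add (by apply Continuous.intervalIntegrable; fun_prop)
      (by apply Continuous.intervalIntegrable; fun_prop),
    intervalIntegral.integral_const_mul, intervalIntegral.integral_const_mul,
    intervalIntegral.integral_const_mul] at hmono
  nlinarith

/-- Density of the equal mixture of the Gaussians of unit variance centered at `a` and `-a`. -/
noncomputable def mixtureDensity (a x : ℝ) : ℝ :=
  (√(2 * π))⁻¹ * ((exp (-(x - a) ^ 2 / 2) + exp (-(x + a) ^ 2 / 2)) / 2)

theorem continuous_mixtureDensity (a : ℝ) : Continuous (mixtureDensity a) := by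
  unfold mixtureDensity; fun_prop

theorem mixtureDensity_nonneg (a x : ℝ) : 0 ≤ mixtureDensity a x := by
  unfold mixtureDensity; positivity

theorem mixtureDensity_neg (a x : ℝ) : mixtureDensity a (-x) = mixtureDensity a x := by
  unfold mixtureDensity; ring_nf

theorem integrable_mixtureDensity (a : ℝ) : Integrable (mixtureDensity a) := by
  have h := integrable_exp_neg_sq_half (-a)
  simp only [sub_neg_eq_add] at h
  exact (((integrable_exp_neg_sq_half a).add h).div_const 2).const_mul _

theorem integral_mixtureDensity (a : ℝ) : ∫ x, mixtureDensity a x = 1 := by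
  have h1 := integrable_exp_neg_sq_half (-a)
  have h2 := integral_exp_neg_sq_half (-a)
  simp only [sub_neg_eq_add] at h1 h2
  unfold mixtureDensity
  rw [integral_const_mul, integral_div, integral_add (integrable_exp_neg_sq_half a) h1,
    integral_exp_neg_sq_half, h2]
  have : √(2 * π) ≠ 0 := by positivity
  field_simp
  norm_num

theorem exp_le_mixtureDensity (a x : ℝ) :
    exp (-(x - a) ^ 2 / 2) ≤ 2 * √(2 * π) * mixtureDensity a x := by
  have : √(2 * π) ≠ 0 := by positivity
  have h : 2 * √(2 * π) * mixtureDensity a x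
      = exp (-(x - a) ^ 2 / 2) + exp (-(x + a) ^ 2 / 2) := by
    unfold mixtureDensity; field_simp
  rw [h]
  linarith [exp_pos (-(x + a) ^ 2 / 2)]

theorem mixtureDensity_le {a x : ℝ} (ha : 0 ≤ a) (hx : 0 ≤ x) :
    mixtureDensity a x ≤ (√(2 * π))⁻¹ * exp (-(x - a) ^ 2 / 2) := by
  unfold mixtureDensity
  gcongr
  have : exp (-(x + a) ^ 2 / 2) ≤ exp (-(x - a) ^ 2 / 2) := by
    rw [exp_le_exp]; nlinarith [mul_nonneg ha hx]
  linarith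

theorem mul_log_div_sub_add_nonneg {t c : ℝ} (ht : 0 ≤ t) (hc : 0 < c) :
    0 ≤ t * log (t / c) - t + c := by
  rcases ht.eq_or_lt with rfl | ht
  · simpa using hc.le
  have h := log_le_sub_one_of_pos (div_pos hc ht)
  rw [← inv_div t c, log_inv, inv_div] at h
  have h2 := mul_le_mul_of_nonneg_left h ht.le
  have : t * (c / t - 1) = c - t := by field_simp
  linarith

theorem hasCompactSupport_sq {f : ℝ → ℝ} (h : HasCompactSupport f) :
    HasCompactSupport fun x => f x ^ 2 :=
  h.comp_left (g := fun y => y ^ 2) (by simp)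

theorem hasCompactSupport_sq_mul_log_div {f : ℝ → ℝ} (h : HasCompactSupport f) (c : ℝ) :
    HasCompactSupport fun x => f x ^ 2 * log (f x ^ 2 / c) :=
  h.comp_left (g := fun y => y ^ 2 * log (y ^ 2 / c)) (by simp)

theorem integral_sq_mul_log_mul_mixtureDensity_le {f : ℝ → ℝ} (hf : ContDiff ℝ 1 f)
    (hs : HasCompactSupport f) {a N ε : ℝ} (ha : 1 ≤ a) (hN : a ≤ N) (hε : 0 < ε) {c : ℝ}
    (hc : c = f 0 ^ 2 + exp (a ^ 2 / 2) / a *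
      (2 * √(2 * π) * (∫ x, deriv f x ^ 2 * mixtureDensity a x) + ε)) :
    ∫ x in (0 : ℝ)..N, (f x ^ 2 * log (f x ^ 2 / c) - f x ^ 2 + c) * mixtureDensity a x
      ≤ 13000 * (√(2 * π))⁻¹ * (exp (a ^ 2 / 2) / a *
        (2 * √(2 * π) * (∫ x, deriv f x ^ 2 * mixtureDensity a x) + ε)) := by
  have ha0 : 0 < a := by linarith
  have hN0 : 0 ≤ N := by linarith
  have hd : Continuous (deriv f) := hf.continuous_deriv le_rfl
  have hq := continuous_mixtureDensity a
  have hcf : Continuous f := hf.continuous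
  have hI0 : 0 ≤ ∫ x, deriv f x ^ 2 * mixtureDensity a x :=
    integral_nonneg fun x => mul_nonneg (sq_nonneg _) (mixtureDensity_nonneg a x)
  set J := 2 * √(2 * π) * (∫ x, deriv f x ^ 2 * mixtureDensity a x) + ε with hJ
  have hJ0 : 0 < J := by positivity
  have hE : ∫ x in (0 : ℝ)..N, deriv f x ^ 2 * exp (-(x - a) ^ 2 / 2) ≤ J := by
    calc _ ≤ ∫ x in (0 : ℝ)..N, 2 * √(2 * π) * (deriv f x ^ 2 * mixtureDensity a x) := by
          refine intervalIntegral.integral_mono_on hN0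
            (by apply Continuous.intervalIntegrable; fun_prop)
            (by apply Continuous.intervalIntegrable; fun_prop) fun x _ => ?_
          have := mul_le_mul_of_nonneg_left (exp_le_mixtureDensity a x) (sq_nonneg (deriv f x))
          linarith
      _ ≤ 2 * √(2 * π) * ∫ x, deriv f x ^ 2 * mixtureDensity a x := by
          rw [intervalIntegral.integral_const_mul, intervalIntegral.integral_of_le hN0]
          refine mul_le_mul_of_nonneg_left (setIntegral_le_integral ?_ (.of_forall fun x =>
            mul_nonneg (sq_nonneg _) (mixtureDensity_nonneg a x))) (by positivity)
          exact ((hd.pow 2).mul hq).integrable_of_hasCompactSupport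
            (hasCompactSupport_sq hs.deriv).mul_right
      _ ≤ J := by rw [hJ]; linarith
  have h := integral_sq_mul_log_mul_exp_le hf ha hN hJ0 hE hc
  have hcpos : 0 < c := by rw [hc]; positivity
  have hcont := continuous_sq_mul_log_div hcf hcpos.ne'
  calc _ ≤ ∫ x in (0 : ℝ)..N, (√(2 * π))⁻¹ *
        ((f x ^ 2 * log (f x ^ 2 / c) - f x ^ 2 + c) * exp (-(x - a) ^ 2 / 2)) := by
        refine intervalIntegral.integral_mono_on hN0
          (by apply Continuous.intervalIntegrable; fun_prop)
          (by apply Continuous.intervalIntegrable; fun_prop) fun x hx => ?_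
        have := mul_le_mul_of_nonneg_left (mixtureDensity_le ha0.le hx.1)
          (mul_log_div_sub_add_nonneg (sq_nonneg (f x)) hcpos)
        linarith
    _ ≤ _ := by
        rw [intervalIntegral.integral_const_mul]
        have := mul_le_mul_of_nonneg_left h (inv_nonneg.2 (sqrt_nonneg (2 * π)))
        linarith

theorem integral_sq_mul_log_div_le {f : ℝ → ℝ} (hf : Continuous f) (hs : HasCompactSupport f)
    (a : ℝ) {c : ℝ} (hc : 0 < c) :
    ∫ x, f x ^ 2 * log (f x ^ 2 / ∫ y, f y ^ 2 * mixtureDensity a y) * mixtureDensity a x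
      ≤ ∫ x, (f x ^ 2 * log (f x ^ 2 / c) - f x ^ 2 + c) * mixtureDensity a x := by
  have hq := continuous_mixtureDensity a
  have hM0 : 0 ≤ ∫ y, f y ^ 2 * mixtureDensity a y :=
    integral_nonneg fun x => mul_nonneg (sq_nonneg _) (mixtureDensity_nonneg a x)
  set M := ∫ y, f y ^ 2 * mixtureDensity a y with hM
  rcases hM0.eq_or_lt with h0 | hMpos
  · rw [← h0]
    simp only [div_zero, log_zero, mul_zero, zero_mul, integral_zero]
    exact integral_nonneg fun x => mul_nonneg
      (mul_log_div_sub_add_nonneg (sq_nonneg (f x)) hc) (mixtureDensity_nonneg a x)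
  have i1 : Integrable fun x => f x ^ 2 * log (f x ^ 2 / c) * mixtureDensity a x :=
    ((continuous_sq_mul_log_div hf hc.ne').mul hq).integrable_of_hasCompactSupport
      (hasCompactSupport_sq_mul_log_div hs c).mul_right
  have i2 : Integrable fun x => f x ^ 2 * mixtureDensity a x :=
    ((hf.pow 2).mul hq).integrable_of_hasCompactSupport (hasCompactSupport_sq hs).mul_right
  have e1 : ∫ x, f x ^ 2 * log (f x ^ 2 / M) * mixtureDensity a x
      = (∫ x, f x ^ 2 * log (f x ^ 2 / c) * mixtureDensity a x) - log (M / c) * M := by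
    rw [hM, ← integral_const_mul, ← hM, ← integral_sub i1 (i2.const_mul _)]
    refine integral_congr_ae (.of_forall fun x => ?_)
    rcases eq_or_ne (f x) 0 with h | h
    · simp [h]
    · simp only
      rw [log_div (by positivity) hMpos.ne', log_div (by positivity) hc.ne',
        log_div hMpos.ne' hc.ne']
      ring
  have e2 : ∫ x, (f x ^ 2 * log (f x ^ 2 / c) - f x ^ 2 + c) * mixtureDensity a x
      = (∫ x, f x ^ 2 * log (f x ^ 2 / c) * mixtureDensity a x) - M + c := by
    have := integral_add (i1.sub i2) ((integrable_mixtureDensity a).const_mul c)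
    rw [integral_sub' i1 i2, integral_const_mul, integral_mixtureDensity, mul_one] at this
    rw [← hM] at this
    rw [← this]
    refine integral_congr_ae (.of_forall fun x => ?_)
    simp only [Pi.sub_apply]
    ring
  rw [e1, e2]
  linarith [mul_log_div_sub_add_nonneg hMpos.le hc]

theorem integral_sq_mul_log_mixtureDensity_le {f : ℝ → ℝ} (hf : ContDiff ℝ 1 f)
    (hs : HasCompactSupport f) {a : ℝ} (ha : 1 ≤ a) :
    ∫ x, f x ^ 2 * log (f x ^ 2 / ∫ y, f y ^ 2 * mixtureDensity a y) * mixtureDensity a x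
      ≤ 52000 * (exp (a ^ 2 / 2) / a) * ∫ x, deriv f x ^ 2 * mixtureDensity a x := by
  have ha0 : 0 < a := by linarith
  have hq := continuous_mixtureDensity a
  have hI0 : 0 ≤ ∫ x, deriv f x ^ 2 * mixtureDensity a x :=
    integral_nonneg fun x => mul_nonneg (sq_nonneg _) (mixtureDensity_nonneg a x)
  have hneg : ∫ x, deriv (fun y => f (-y)) x ^ 2 * mixtureDensity a x
      = ∫ x, deriv f x ^ 2 * mixtureDensity a x := by
    rw [← integral_neg_eq_self]
    refine integral_congr_ae (.of_forall fun x => ?_)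
    simp only [deriv_comp_neg, neg_neg, even_two.neg_pow, mixtureDensity_neg]
  set I := ∫ x, deriv f x ^ 2 * mixtureDensity a x with hI
  set T := exp (a ^ 2 / 2) / a with hT
  have hT0 : 0 < T := by positivity
  set Z := √(2 * π) with hZ
  have hZ0 : 0 < Z := by positivity
  have key : ∀ ε > 0,
      ∫ x, f x ^ 2 * log (f x ^ 2 / ∫ y, f y ^ 2 * mixtureDensity a y) * mixtureDensity a x
        ≤ 26000 * Z⁻¹ * (T * (2 * Z * I + ε)) := by
    intro ε hε
    set c := f 0 ^ 2 + T * (2 * Z * I + ε) with hc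
    have hcpos : 0 < c := by positivity
    have hcont := continuous_sq_mul_log_div hf.continuous hcpos.ne'
    have hcf := hf.continuous
    have hint : Integrable fun x =>
        (f x ^ 2 * log (f x ^ 2 / c) - f x ^ 2 + c) * mixtureDensity a x := by
      have i1 : Integrable fun x => (f x ^ 2 * log (f x ^ 2 / c) - f x ^ 2) * mixtureDensity a x :=
        ((hcont.sub (hcf.pow 2)).mul hq).integrable_of_hasCompactSupport
          ((hasCompactSupport_sq_mul_log_div hs c).sub (hasCompactSupport_sq hs)).mul_right
      refine (i1.add ((integrable_mixtureDensity a).const_mul c)).congr (.of_forall fun x => ?_)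
      simp only [Pi.add_apply]
      ring
    refine (integral_sq_mul_log_div_le hcf hs a hcpos).trans ?_
    refine le_of_tendsto (intervalIntegral_tendsto_integral hint Filter.tendsto_neg_atTop_atBot
      Filter.tendsto_id) ?_
    filter_upwards [Filter.eventually_ge_atTop a] with N hN
    have hp := integral_sq_mul_log_mul_mixtureDensity_le hf hs ha hN hε hc
    have hm := integral_sq_mul_log_mul_mixtureDensity_le (f := fun y => f (-y))
      (hf.comp contDiff_neg) (hs.comp_homeomorph (Homeomorph.neg ℝ)) ha hN hε (c := c)
      (by rw [hneg, neg_zero])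
    rw [hneg] at hm
    have hrefl : ∫ x in (0 : ℝ)..N,
        (f (-x) ^ 2 * log (f (-x) ^ 2 / c) - f (-x) ^ 2 + c) * mixtureDensity a x
        = ∫ x in (-N)..0, (f x ^ 2 * log (f x ^ 2 / c) - f x ^ 2 + c) * mixtureDensity a x := by
      have := intervalIntegral.integral_comp_neg (a := 0) (b := N) fun x =>
        (f x ^ 2 * log (f x ^ 2 / c) - f x ^ 2 + c) * mixtureDensity a x
      simpa only [mixtureDensity_neg, neg_zero] using this
    rw [hrefl] at hm
    rw [id, ← intervalIntegral.integral_add_adjacent_intervals (b := 0)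
      (by apply Continuous.intervalIntegrable; fun_prop)
      (by apply Continuous.intervalIntegrable; fun_prop)]
    linarith
  refine le_of_forall_pos_le_add fun η hη => ?_
  have h := key (η * Z / (26000 * T)) (by positivity)
  refine h.trans_eq ?_
  field_simp
  ring

theorem gaussianMeasure_eq_gaussianReal {δ : ℝ} (hδ : 0 < δ) :
    gaussianMeasure δ = ProbabilityTheory.gaussianReal 0 δ.toNNReal := by
  rw [ProbabilityTheory.gaussianReal_of_var_ne_zero _ (by simpa using hδ)]
  unfold gaussianMeasure ProbabilityTheory.gaussianPDF ProbabilityTheory.gaussianPDFReal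
  simp [hδ.le]

theorem mconv_dirac_gaussianMeasure (R : ℝ) {δ : ℝ} (hδ : 0 < δ) :
    mconv (((1 : ENNReal) / 2) • (Measure.dirac (-R) + Measure.dirac R)) (gaussianMeasure δ)
      = ((1 : ENNReal) / 2) • (ProbabilityTheory.gaussianReal (-R) δ.toNNReal
        + ProbabilityTheory.gaussianReal R δ.toNNReal) := by
  have hmeas : Measurable fun p : ℝ × ℝ => p.1 + p.2 := by fun_prop
  have h : ∀ r : ℝ, ((Measure.dirac r).prod (gaussianMeasure δ)).map (fun p => p.1 + p.2)
      = ProbabilityTheory.gaussianReal r δ.toNNReal := by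
    intro r
    rw [gaussianMeasure_eq_gaussianReal hδ, Measure.dirac_prod,
      Measure.map_map hmeas measurable_prodMk_left]
    have := ProbabilityTheory.gaussianReal_map_const_add (μ := 0) (v := δ.toNNReal) r
    rw [zero_add] at this
    exact this
  have : SFinite (gaussianMeasure δ) := by
    rw [gaussianMeasure_eq_gaussianReal hδ]; infer_instance
  unfold mconv
  rw [Measure.prod_smul_left, Measure.add_prod, Measure.map_smul, Measure.map_add _ _ hmeas,
    h, h]

theorem integral_mconv_eq (R : ℝ) {δ : ℝ} (hδ : 0 < δ) {g : ℝ → ℝ} (hg : Continuous g)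
    (hs : HasCompactSupport g) :
    ∫ t, g t ∂(mconv (((1 : ENNReal) / 2) • (Measure.dirac (-R) + Measure.dirac R))
        (gaussianMeasure δ))
      = ∫ x, g (√δ * x) * mixtureDensity (R / √δ) x := by
  have hδ' : δ.toNNReal ≠ 0 := by simpa using hδ
  have hsq : 0 < √δ := sqrt_pos.2 hδ
  have hcomp : ∀ r, ∫ t, g t ∂(ProbabilityTheory.gaussianReal r δ.toNNReal)
      = ∫ x, (√(2 * π))⁻¹ * (g (√δ * x) * exp (-(x - r / √δ) ^ 2 / 2)) := by
    intro r
    rw [ProbabilityTheory.integral_gaussianReal_eq_integral_smul hδ']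
    have h := Measure.integral_comp_mul_left
      (fun x => ProbabilityTheory.gaussianPDFReal r δ.toNNReal x • g x) (√δ)
    rw [abs_of_pos (inv_pos.2 hsq), smul_eq_mul, eq_comm, inv_mul_eq_iff_eq_mul₀ hsq.ne',
      ← integral_const_mul] at h
    rw [h]
    refine integral_congr_ae (.of_forall fun x => ?_)
    simp only [ProbabilityTheory.gaussianPDFReal, Real.coe_toNNReal _ hδ.le, smul_eq_mul]
    rw [sqrt_mul (by positivity) δ]
    have e : -(√δ * x - r) ^ 2 / (2 * δ) = -(x - r / √δ) ^ 2 / 2 := by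
      nth_rw 2 [← sq_sqrt hδ.le]
      field_simp
    rw [e]
    field_simp
  have hi : ∀ b : ℝ,
      Integrable fun x => (√(2 * π))⁻¹ * (g (√δ * x) * exp (-(x - b) ^ 2 / 2)) := by
    intro b
    refine Integrable.const_mul (Continuous.integrable_of_hasCompactSupport (by fun_prop) ?_) _
    exact HasCompactSupport.mul_right
      (hs.comp_homeomorph (Homeomorph.mulLeft₀ (√δ) hsq.ne'))
  rw [mconv_dirac_gaussianMeasure R hδ, integral_smul_measure, integral_add_measure
    (hg.integrable_of_hasCompactSupport hs) (hg.integrable_of_hasCompactSupport hs),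
    hcomp, hcomp, ← integral_add (hi _) (hi _), smul_eq_mul, ← integral_const_mul]
  refine integral_congr_ae (.of_forall fun x => ?_)
  simp only [mixtureDensity, one_div, ENNReal.toReal_inv, ENNReal.toReal_ofNat]
  ring_nf

theorem stmt18 (R : ℝ) (hR : 0 < R) (δ : ℝ) (hδpos : 0 < δ) (hδ : δ ≤ R ^ 2) :
    SatisfiesLSI
      (mconv (((1 : ENNReal) / 2) • (Measure.dirac (-R) + Measure.dirac R)) (gaussianMeasure δ))
      (117942 * (δ ^ ((3 : ℝ) / 2) / R) * Real.exp (R ^ 2 / (2 * δ))) := by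
  intro f hf hs
  have hsq : 0 < √δ := sqrt_pos.2 hδpos
  have hf1 : ContDiff ℝ 1 f := hf.of_le (by exact_mod_cast le_top)
  have hd : Continuous (deriv f) := hf1.continuous_deriv le_rfl
  have ha : 1 ≤ R / √δ := by
    rw [one_le_div hsq, sqrt_le_left hR.le]
    exact hδ
  have hM := integral_mconv_eq R hδpos (hf1.continuous.pow 2) (hasCompactSupport_sq hs)
  have hD := integral_mconv_eq R hδpos (hd.pow 2) (hasCompactSupport_sq hs.deriv)
  have hcomp : ContDiff ℝ 1 fun x => f (√δ * x) := hf1.comp (contDiff_const.mul contDiff_id)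
  have hscomp : HasCompactSupport fun x => f (√δ * x) :=
    hs.comp_homeomorph (Homeomorph.mulLeft₀ (√δ) hsq.ne')
  have key := integral_sq_mul_log_mixtureDensity_le hcomp hscomp ha
  simp only [Pi.pow_apply] at hM hD
  have hEnt : Ent (mconv (((1 : ENNReal) / 2) • (Measure.dirac (-R) + Measure.dirac R))
      (gaussianMeasure δ)) (fun t => f t ^ 2)
      = ∫ x, f (√δ * x) ^ 2 * log (f (√δ * x) ^ 2 /
          ∫ y, f (√δ * y) ^ 2 * mixtureDensity (R / √δ) y) * mixtureDensity (R / √δ) x := by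
    unfold Ent
    rw [hM]
    set M := ∫ y, f (√δ * y) ^ 2 * mixtureDensity (R / √δ) y
    rcases eq_or_ne M 0 with h0 | h0
    · simp [h0]
    · exact integral_mconv_eq R hδpos (continuous_sq_mul_log_div hf1.continuous h0)
        (hasCompactSupport_sq_mul_log_div hs M)
  have hderiv : ∫ x, deriv (fun y => f (√δ * y)) x ^ 2 * mixtureDensity (R / √δ) x
      = δ * ∫ x, deriv f (√δ * x) ^ 2 * mixtureDensity (R / √δ) x := by
    rw [← integral_const_mul]
    refine integral_congr_ae (.of_forall fun x => ?_)
    simp only [deriv_comp_mul_left, smul_eq_mul, mul_pow, sq_sqrt hδpos.le, mul_assoc]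
  have hD0 : 0 ≤ ∫ x, deriv f (√δ * x) ^ 2 * mixtureDensity (R / √δ) x :=
    integral_nonneg fun x => mul_nonneg (sq_nonneg _) (mixtureDensity_nonneg _ x)
  rw [hEnt, hD]
  rw [hderiv] at key
  refine key.trans ?_
  have h32 : δ ^ ((3 : ℝ) / 2) = δ * √δ := by
    rw [sqrt_eq_rpow, ← rpow_one_add' hδpos.le (by norm_num)]
    norm_num
  have he : (R / √δ) ^ 2 / 2 = R ^ 2 / (2 * δ) := by
    rw [div_pow, sq_sqrt hδpos.le]
    field_simp
  rw [h32, he]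
  calc _ = 52000 * (δ * √δ / R) * exp (R ^ 2 / (2 * δ)) *
        ∫ x, deriv f (√δ * x) ^ 2 * mixtureDensity (R / √δ) x := by
        field_simp
    _ ≤ _ := by
        gcongr
        norm_num
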